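/- If p and q are odd coprime integers with p, q ≥ 3, then the ordinary signature of the torus knot T_{p,q} satisfies σ_ord(T_{p,q}) = −pq/2 + 2p/(3q) + 2q/(3p) + 1/(6pq) − 4(s(2p,q) + s(2q,p)) − 1. -/

import Mathlib

open scoped Classical

/-- The set Σ(p,q) = {k/p + l/q : 1 ≤ k ≤ p−1, 1 ≤ l ≤ q−1} ⊆ ℝ. -/
noncomputable def sigmaSet (p q : ℕ) : Finset ℝ :=
  ((Finset.Icc 1 (p - 1)) ×ˢ (Finset.Icc 1 (q - 1))).image
    (fun kl => (kl.1 : ℝ) / p + (kl.2 : ℝ) / q)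

/-- Litherland's formula: σ̂(x) = |Σ(p,q) \ (x,x+1)| − |Σ(p,q) ∩ (x,x+1)|. -/
noncomputable def sigHat (p q : ℕ) (x : ℝ) : ℤ :=
  (((sigmaSet p q).filter (fun y => y ∉ Set.Ioo x (x + 1))).card : ℤ)
    - (((sigmaSet p q).filter (fun y => y ∈ Set.Ioo x (x + 1))).card : ℤ)

/-- The sawtooth function ((x)). -/
noncomputable def saw (x : ℝ) : ℝ :=
  if ∃ n : ℤ, x = n then 0 else Int.fract x - 1 / 2

/-- The Dedekind sum s(a,b). -/
noncomputable def dedekindSum (a b : ℕ) : ℝ :=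
  ∑ j ∈ Finset.range b, saw ((j : ℝ) / b) * saw ((a : ℝ) * j / b)

/-- The generalized Dedekind sum s(a,b;x,y). -/
noncomputable def dedekindSumGen (a b : ℕ) (x y : ℝ) : ℝ :=
  ∑ j ∈ Finset.range b, saw (((j : ℝ) + y) / b) * saw ((a : ℝ) * ((j : ℝ) + y) / b + x)

/-- N(p,q;C) = #{(k,l) ∈ ℤ²_{≥0} : k/p + l/q < 1 − C}. -/
noncomputable def Ncount (p q : ℕ) (C : ℝ) : ℕ :=
  Set.ncard {kl : ℕ × ℕ | (kl.1 : ℝ) / p + (kl.2 : ℝ) / q < 1 - C}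

/-- The second Bernoulli polynomial evaluated at the fractional part: Ψ₂(x). -/
noncomputable def psi2 (x : ℝ) : ℝ := Int.fract x ^ 2 - Int.fract x + 1 / 6

/-- Affine permutation of residues. -/
lemma aux_perm (n a c : ℕ) (hn : 0 < n) (ha : Nat.Coprime a n) (F : ℕ → ℝ) :
    ∑ l ∈ Finset.range n, F ((c + a * l) % n) = ∑ j ∈ Finset.range n, F j := by
  have hmaps : Set.MapsTo (fun l => (c + a * l) % n) (Finset.range n : Set ℕ)
      (Finset.range n : Set ℕ) := by
    intro l _
    simpa using Nat.mod_lt _ hn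
  have hinj : Set.InjOn (fun l => (c + a * l) % n) (Finset.range n : Set ℕ) := by
    intro x hx y hy hxy
    have h1 : c + a * x ≡ c + a * y [MOD n] := hxy
    have h2 : a * x ≡ a * y [MOD n] := Nat.ModEq.add_left_cancel' c h1
    have h3 : x ≡ y [MOD n] := Nat.ModEq.cancel_left_of_coprime (by
      simpa [Nat.Coprime, Nat.gcd_comm] using ha) h2
    simp only [Finset.coe_range, Set.mem_Iio] at hx hy
    exact Nat.ModEq.eq_of_lt_of_lt h3 hx hy
  exact Finset.sum_nbij (fun l => (c + a * l) % n) (fun l hl => hmaps hl) hinj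
    (Finset.surjOn_of_injOn_of_card_le _ hmaps hinj le_rfl) (fun _ _ => rfl)

/-- The inner sum over `l` of a function of `2(kq+lp) mod pq`. -/
lemma aux_inner (p q k : ℕ) (hp : 0 < p) (hq : 0 < q) (hoq : Odd q) (F : ℕ → ℝ) :
    ∑ l ∈ Finset.range q, F ((2 * (k * q + l * p)) % (p * q))
      = ∑ j ∈ Finset.range q, F (p * j + (2 * q * k) % p) := by
  rw [← aux_perm q 2 ((2 * q * k) / p) hq (Nat.coprime_two_left.2 hoq)
    (fun j => F (p * j + (2 * q * k) % p))]
  refine Finset.sum_congr rfl fun l _ => ?_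
  congr 1
  have h1 : 2 * (k * q + l * p) = 2 * q * k + p * (2 * l) := by ring
  rw [h1, Nat.mod_mul, Nat.add_mul_mod_self_left, Nat.add_mul_div_left _ _ hp, add_comm]

lemma aux_sum_id (n : ℕ) : ∑ j ∈ Finset.range n, (j : ℝ) = n * (n - 1) / 2 := by
  induction n with
  | zero => simp
  | succ n ih => rw [Finset.sum_range_succ, ih]; push_cast; ring

lemma aux_sum_sq (n : ℕ) :
    ∑ j ∈ Finset.range n, (j : ℝ) ^ 2 = n * (n - 1) * (2 * n - 1) / 6 := by
  induction n with
  | zero => simp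
  | succ n ih => rw [Finset.sum_range_succ, ih]; push_cast; ring

/-- centred residue -/
noncomputable def aom (p q X : ℕ) : ℝ := ((X % (p * q) : ℕ) : ℝ) / (p * q) - 1 / 2

lemma aux_inner_lin (p q k : ℕ) (hp : 0 < p) (hq : 0 < q) (hoq : Odd q) :
    ∑ l ∈ Finset.range q, aom p q (2 * (k * q + l * p))
      = (((2 * q * k) % p : ℕ) : ℝ) / p - 1 / 2 := by
  have hp' : (p : ℝ) ≠ 0 := by positivity
  have hq' : (q : ℝ) ≠ 0 := by positivity
  unfold aom
  rw [aux_inner p q k hp hq hoq (fun x => (x : ℝ) / (p * q) - 1 / 2)]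
  generalize (2 * q * k) % p = r
  push_cast
  rw [Finset.sum_sub_distrib, ← Finset.sum_div, Finset.sum_add_distrib, ← Finset.mul_sum,
    aux_sum_id]
  simp
  field_simp
  ring

lemma aux_sq (p q : ℕ) (hp : 0 < p) (hq : 0 < q) (hop : Odd p) (hoq : Odd q)
    (hpq : Nat.Coprime p q) :
    ∑ k ∈ Finset.range p, ∑ l ∈ Finset.range q, aom p q (2 * (k * q + l * p)) ^ 2
      = p * q / 12 + 1 / (6 * p * q) := by
  have hp' : (p : ℝ) ≠ 0 := by positivity
  have hq' : (q : ℝ) ≠ 0 := by positivity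
  unfold aom
  have h1 : ∀ k ∈ Finset.range p, ∑ l ∈ Finset.range q,
      ((((2 * (k * q + l * p)) % (p * q) : ℕ) : ℝ) / (p * q) - 1 / 2) ^ 2
      = (fun r : ℕ => ∑ j ∈ Finset.range q, (((p * j + r : ℕ) : ℝ) / (p * q) - 1 / 2) ^ 2)
        ((0 + 2 * q * k) % p) := by
    intro k _
    rw [aux_inner p q k hp hq hoq (fun x => ((x : ℝ) / (p * q) - 1 / 2) ^ 2)]
    simp
  rw [Finset.sum_congr rfl h1, aux_perm p (2 * q) 0 hp
    (Nat.Coprime.mul_left (Nat.coprime_two_left.2 hop) hpq.symm)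
    (fun r : ℕ => ∑ j ∈ Finset.range q, (((p * j + r : ℕ) : ℝ) / (p * q) - 1 / 2) ^ 2)]
  have h2 : ∀ r ∈ Finset.range p,
      ∑ j ∈ Finset.range q, (((p * j + r : ℕ) : ℝ) / (p * q) - 1 / 2) ^ 2
      = (r : ℝ) ^ 2 * (1 / (p ^ 2 * q)) + r * (-1 / (p * q)) + (q / 12 + 1 / (6 * q)) := by
    intro r _
    have : ∀ j ∈ Finset.range q, (((p * j + r : ℕ) : ℝ) / (p * q) - 1 / 2) ^ 2
        = (j : ℝ) ^ 2 * (1 / q ^ 2) + j * (2 / q * (r / (p * q) - 1 / 2))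
          + (r / (p * q) - 1 / 2) ^ 2 := by
      intro j _
      push_cast
      field_simp
      ring
    rw [Finset.sum_congr rfl this, Finset.sum_add_distrib, Finset.sum_add_distrib,
      ← Finset.sum_mul, ← Finset.sum_mul, aux_sum_id, aux_sum_sq]
    simp
    field_simp
    ring
  rw [Finset.sum_congr rfl h2, Finset.sum_add_distrib, Finset.sum_add_distrib,
      ← Finset.sum_mul, ← Finset.sum_mul, aux_sum_id, aux_sum_sq]
  simp
  field_simp
  ring

lemma saw_div (n p : ℕ) (hp : 0 < p) :
    saw ((n : ℝ) / p) = if p ∣ n then 0 else ((n % p : ℕ) : ℝ) / p - 1 / 2 := by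
  have hp' : (p : ℝ) ≠ 0 := by positivity
  unfold saw
  have h : (∃ m : ℤ, (n : ℝ) / p = m) ↔ p ∣ n := by
    constructor
    · rintro ⟨m, hm⟩
      rw [div_eq_iff hp'] at hm
      have : (n : ℤ) = m * p := by exact_mod_cast hm
      exact Int.natCast_dvd_natCast.1 ⟨m, by rw [this]; ring⟩
    · rintro ⟨m, rfl⟩
      exact ⟨m, by push_cast; field_simp⟩
  simp only [h]
  congr 1
  congr 1
  rw [Int.fract_eq_iff]
  refine ⟨by positivity, ?_, (n / p : ℕ), ?_⟩
  · rw [div_lt_one (by positivity)]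
    exact_mod_cast Nat.mod_lt _ hp
  · have : (n : ℝ) = p * (n / p : ℕ) + (n % p : ℕ) := by exact_mod_cast (Nat.div_add_mod n p).symm
    rw [Int.cast_natCast]
    field_simp
    linarith

lemma aux_ded (p a : ℕ) (hp : 0 < p) (ha : Nat.Coprime a p) :
    ∑ k ∈ Finset.range p, ((k : ℝ) / p - 1 / 2) * (((a * k % p : ℕ) : ℝ) / p - 1 / 2)
      = dedekindSum a p + 1 / 4 := by
  unfold dedekindSum
  obtain ⟨n, rfl⟩ : ∃ n, p = n + 1 := ⟨p - 1, by omega⟩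
  rw [Finset.sum_range_succ', Finset.sum_range_succ']
  have h0 : saw 0 = 0 := by
    unfold saw
    rw [if_pos ⟨0, by simp⟩]
  have : ∀ k ∈ Finset.range n,
      saw (((k + 1 : ℕ) : ℝ) / (n + 1 : ℕ)) * saw ((a : ℝ) * ((k + 1 : ℕ) : ℝ) / (n + 1 : ℕ))
      = (((k + 1 : ℕ) : ℝ) / (n + 1 : ℕ) - 1 / 2)
        * (((a * (k + 1) % (n + 1) : ℕ) : ℝ) / (n + 1 : ℕ) - 1 / 2) := by
    intro k hk
    have hk' := Finset.mem_range.1 hk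
    have h1 : ¬ (n + 1 ∣ k + 1) := fun h => by
      have := Nat.le_of_dvd (by omega) h
      omega
    have h2 : ¬ (n + 1 ∣ a * (k + 1)) := fun h => h1 (ha.symm.dvd_of_dvd_mul_left h)
    rw [← Nat.cast_mul, saw_div _ _ hp, saw_div _ _ hp, if_neg h1, if_neg h2,
      Nat.mod_eq_of_lt (by omega : k + 1 < n + 1)]
  rw [Finset.sum_congr rfl this]
  simp [h0]
  norm_num

/-- the sign attached to `X = 2(kq+lp)` -/
noncomputable def aeps (p q X : ℕ) : ℝ := (3 / 2 - ((X / (p * q) : ℕ) : ℝ)) ^ 2 - 5 / 4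

lemma aeps_formula (p q k l : ℕ) (hp : 0 < p) (hq : 0 < q) :
    aeps p q (2 * (k * q + l * p)) =
      -4 * (((k : ℝ) / p - 1 / 2) * aom p q (2 * (k * q + l * p)))
      - 4 * (((l : ℝ) / q - 1 / 2) * aom p q (2 * (k * q + l * p)))
      + aom p q (2 * (k * q + l * p)) ^ 2
      + 4 * ((k : ℝ) / p - 1 / 2) ^ 2 + 4 * ((l : ℝ) / q - 1 / 2) ^ 2
      + 8 * (((k : ℝ) / p - 1 / 2) * ((l : ℝ) / q - 1 / 2)) - 5 / 4 := by
  have hp' : (p : ℝ) ≠ 0 := by positivity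
  have hq' : (q : ℝ) ≠ 0 := by positivity
  have h : ((2 * (k * q + l * p) : ℕ) : ℝ) = ((p * q : ℕ) : ℝ)
      * ((2 * (k * q + l * p)) / (p * q) : ℕ) + ((2 * (k * q + l * p)) % (p * q) : ℕ) := by
    exact_mod_cast (Nat.div_add_mod (2 * (k * q + l * p)) (p * q)).symm
  unfold aeps aom
  generalize (2 * (k * q + l * p)) / (p * q) = m at *
  generalize (2 * (k * q + l * p)) % (p * q) = r at *
  push_cast at h
  have h' : (r : ℝ) / (p * q) = 2 * (k / p + l / q) - m := by
    field_simp
    linarith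
  rw [h']
  ring

lemma aux_center (p : ℕ) (hp : 0 < p) :
    ∑ k ∈ Finset.range p, ((k : ℝ) / p - 1 / 2) = -1 / 2 := by
  have hp' : (p : ℝ) ≠ 0 := by positivity
  rw [Finset.sum_sub_distrib, ← Finset.sum_div, aux_sum_id]
  simp
  field_simp
  ring

lemma aux_center_sq (p : ℕ) (hp : 0 < p) :
    ∑ k ∈ Finset.range p, (((k : ℝ) / p - 1 / 2) ^ 2 : ℝ) = (p : ℝ) / 12 + 1 / (6 * (p : ℝ)) := by
  have hp' : (p : ℝ) ≠ 0 := by positivity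
  have : ∀ k ∈ Finset.range p, ((k : ℝ) / p - 1 / 2) ^ 2
      = (k : ℝ) ^ 2 * (1 / p ^ 2) + k * (-1 / p) + 1 / 4 := by
    intro k _
    field_simp
    ring
  rw [Finset.sum_congr rfl this, Finset.sum_add_distrib, Finset.sum_add_distrib,
    ← Finset.sum_mul, ← Finset.sum_mul, aux_sum_id, aux_sum_sq]
  simp
  field_simp
  ring

lemma aux_cross (p q : ℕ) (hp : 0 < p) (hq : 0 < q) (hop : Odd p) (hoq : Odd q)
    (hpq : Nat.Coprime p q) :
    ∑ k ∈ Finset.range p, ∑ l ∈ Finset.range q,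
      (((k : ℝ) / p - 1 / 2) * aom p q (2 * (k * q + l * p))) = dedekindSum (2 * q) p + 1 / 4 := by
  rw [← aux_ded p (2 * q) hp (Nat.Coprime.mul_left (Nat.coprime_two_left.2 hop) hpq.symm)]
  refine Finset.sum_congr rfl fun k _ => ?_
  rw [← Finset.mul_sum, aux_inner_lin p q k hp hq hoq]

lemma aom_symm (p q k l : ℕ) :
    aom p q (2 * (k * q + l * p)) = aom q p (2 * (l * p + k * q)) := by
  unfold aom
  rw [add_comm (k * q), mul_comm p q, mul_comm (p : ℝ) q]

lemma aux_full (p q : ℕ) (hp : 0 < p) (hq : 0 < q) (hop : Odd p) (hoq : Odd q)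
    (hpq : Nat.Coprime p q) :
    ∑ k ∈ Finset.range p, ∑ l ∈ Finset.range q, aeps p q (2 * (k * q + l * p)) =
      -(p * q)/2 + 2 * p/(3 * q) + 2 * q/(3 * p) + 1/(6 * p * q)
        - 4 * (dedekindSum (2 * p) q + dedekindSum (2 * q) p) := by
  have hp' : (p : ℝ) ≠ 0 := by positivity
  have hq' : (q : ℝ) ≠ 0 := by positivity
  have c1 := aux_cross p q hp hq hop hoq hpq
  simp only [← Finset.mul_sum] at c1
  have c2 : ∑ k ∈ Finset.range p, ∑ l ∈ Finset.range q,
      (((l : ℝ) / q - 1 / 2) * aom p q (2 * (k * q + l * p)))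
      = dedekindSum (2 * p) q + 1 / 4 := by
    rw [← aux_cross q p hq hp hoq hop hpq.symm, Finset.sum_comm]
    simp only [aom_symm p q]
  simp only [aeps_formula p q _ _ hp hq, Finset.sum_add_distrib, Finset.sum_sub_distrib,
    ← Finset.mul_sum, c1, c2, aux_sq p q hp hq hop hoq hpq, aux_center_sq q hq,
    aux_center q hq, Finset.sum_const, Finset.card_range, nsmul_eq_mul, ← Finset.sum_mul,
    aux_center p hp, aux_center_sq p hp]
  field_simp
  ring

lemma aux_boundary (p q : ℕ) (hp : 0 < p) (hoq : Odd q) :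
    ∑ l ∈ Finset.range q, aeps p q (2 * (0 * q + l * p)) = 1 := by
  obtain ⟨n, rfl⟩ := hoq
  have h : ∀ l, 2 * (0 * (2 * n + 1) + l * p) / (p * (2 * n + 1)) = 2 * l / (2 * n + 1) := by
    intro l
    rw [show 2 * (0 * (2 * n + 1) + l * p) = p * (2 * l) by ring, Nat.mul_div_mul_left _ _ hp]
  simp only [aeps, h]
  rw [show 2 * n + 1 = (n + 1) + n by ring, Finset.sum_range_add]
  have h1 : ∀ l ∈ Finset.range (n + 1),
      (3 / 2 - ((2 * l / (n + 1 + n) : ℕ) : ℝ)) ^ 2 - 5 / 4 = 1 := by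
    intro l hl
    have := Finset.mem_range.1 hl
    rw [Nat.div_eq_of_lt (by omega)]
    norm_num
  have h2 : ∀ l ∈ Finset.range n,
      (3 / 2 - ((2 * (n + 1 + l) / (n + 1 + n) : ℕ) : ℝ)) ^ 2 - 5 / 4 = -1 := by
    intro l hl
    have := Finset.mem_range.1 hl
    rw [Nat.div_eq_of_lt_le (k := 1) (by omega) (by omega)]
    norm_num
  rw [Finset.sum_congr rfl h1, Finset.sum_congr rfl h2]
  simp

lemma aeps_symm (p q k l : ℕ) :
    aeps p q (2 * (k * q + l * p)) = aeps q p (2 * (l * p + k * q)) := by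
  unfold aeps
  rw [add_comm (k * q), mul_comm p q]

lemma aux_split (n : ℕ) (hn : 0 < n) (f : ℕ → ℝ) :
    ∑ k ∈ Finset.range n, f k = f 0 + ∑ k ∈ Finset.Icc 1 (n - 1), f k := by
  obtain ⟨m, rfl⟩ : ∃ m, n = m + 1 := ⟨n - 1, by omega⟩
  rw [Finset.sum_range_succ', add_comm, Finset.range_eq_Ico,
    Finset.sum_Ico_add' (fun k => f k) 0 m 1]
  rfl

lemma aeps_sign (p q k l : ℕ) (hp : 0 < p) (hq : 0 < q) (hop : Odd p) (hoq : Odd q)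
    (hk : k < p) (hl : l < q) :
    aeps p q (2 * (k * q + l * p)) =
      if ((k : ℝ) / p + (l : ℝ) / q) ∈ Set.Ioo (1 / 2 : ℝ) (1 / 2 + 1) then -1 else 1 := by
  have hp' : (0 : ℝ) < p := by positivity
  have hq' : (0 : ℝ) < q := by positivity
  have hodd : Odd (p * q) := hop.mul hoq
  have hz : (k : ℝ) / p + (l : ℝ) / q = ((k * q + l * p : ℕ) : ℝ) / ((p * q : ℕ) : ℝ) := by
    push_cast
    field_simp
  have hpos : (0 : ℝ) < ((p * q : ℕ) : ℝ) := by positivity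
  have hmem : ((k : ℝ) / p + (l : ℝ) / q) ∈ Set.Ioo (1 / 2 : ℝ) (1 / 2 + 1) ↔
      p * q < 2 * (k * q + l * p) ∧ 2 * (k * q + l * p) < 3 * (p * q) := by
    rw [hz, Set.mem_Ioo, lt_div_iff₀ hpos, div_lt_iff₀ hpos,
      ← Nat.cast_lt (α := ℝ), ← Nat.cast_lt (α := ℝ) (n := 3 * (p * q)), Nat.cast_mul 2,
      Nat.cast_mul 3]
    constructor <;> rintro ⟨h1, h2⟩ <;> constructor <;> push_cast at * <;> linarith
  have hlt : k * q + l * p < 2 * (p * q) := by nlinarith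
  simp only [hmem]
  unfold aeps
  have hN : 0 < p * q := Nat.mul_pos hp hq
  generalize k * q + l * p = Y at *
  generalize p * q = N at *
  obtain ⟨n, rfl⟩ := hodd
  rcases lt_or_ge (2 * Y) (2 * n + 1) with h | h
  · rw [Nat.div_eq_of_lt h, if_neg (by omega)]; norm_num
  rcases lt_or_ge (2 * Y) (2 * (2 * n + 1)) with h' | h'
  · rw [Nat.div_eq_of_lt_le (k := 1) (by omega) (by omega), if_pos (by omega)]; norm_num
  rcases lt_or_ge (2 * Y) (3 * (2 * n + 1)) with h'' | h''
  · rw [Nat.div_eq_of_lt_le (k := 2) (by omega) (by omega), if_pos (by omega)]; norm_num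
  · rw [Nat.div_eq_of_lt_le (k := 3) (by omega) (by omega), if_neg (by omega)]; norm_num

lemma aux_injOn (p q : ℕ) (hp : 0 < p) (hq : 0 < q) (hpq : Nat.Coprime p q) :
    Set.InjOn (fun kl : ℕ × ℕ => (kl.1 : ℝ) / p + (kl.2 : ℝ) / q)
      (((Finset.Icc 1 (p - 1)) ×ˢ (Finset.Icc 1 (q - 1)) : Finset (ℕ × ℕ)) : Set (ℕ × ℕ)) := by
  rintro ⟨k, l⟩ h1 ⟨k', l'⟩ h2 h
  simp only [Finset.coe_product, Set.mem_prod, Finset.coe_Icc, Set.mem_Icc] at h1 h2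
  have hp' : (p : ℝ) ≠ 0 := by positivity
  have hq' : (q : ℝ) ≠ 0 := by positivity
  simp only at h
  field_simp at h
  have e : k * q + p * l = k' * q + p * l' := by exact_mod_cast (by linarith : (k * q + p * l : ℝ) = k' * q + p * l')
  have m1 : k * q ≡ k' * q [MOD p] := by
    have : (k * q + p * l) % p = (k' * q + p * l') % p := by rw [e]
    simpa [Nat.ModEq] using this
  have m2 : k ≡ k' [MOD p] := Nat.ModEq.cancel_right_of_coprime hpq m1
  have e1 : k = k' := Nat.ModEq.eq_of_lt_of_lt m2 (by omega) (by omega)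
  subst e1
  have e2 : l = l' := Nat.eq_of_mul_eq_mul_left hp (by omega)
  rw [e2]

lemma sigHat_eq (p q : ℕ) (hp : 0 < p) (hq : 0 < q) (hop : Odd p) (hoq : Odd q)
    (hpq : Nat.Coprime p q) :
    (sigHat p q (1/2) : ℝ) = ∑ k ∈ Finset.Icc 1 (p - 1), ∑ l ∈ Finset.Icc 1 (q - 1),
      aeps p q (2 * (k * q + l * p)) := by
  have h1 : (sigHat p q (1/2) : ℝ) = ∑ y ∈ sigmaSet p q,
      if y ∈ Set.Ioo (1 / 2 : ℝ) (1 / 2 + 1) then (-1 : ℝ) else 1 := by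
    unfold sigHat
    rw [Finset.sum_ite]
    simp only [Finset.sum_const, nsmul_eq_mul]
    push_cast
    ring
  rw [h1, sigmaSet, Finset.sum_image (aux_injOn p q hp hq hpq), Finset.sum_product]
  refine Finset.sum_congr rfl fun k hk => Finset.sum_congr rfl fun l hl => ?_
  rw [Finset.mem_Icc] at hk hl
  rw [aeps_sign p q k l hp hq hop hoq (by omega) (by omega)]

theorem sigma_ord_odd_odd (p q : ℕ) (hp : 3 ≤ p) (hq : 3 ≤ q)
    (hop : Odd p) (hoq : Odd q) (hpq : Nat.Coprime p q) :
    (sigHat p q (1/2) : ℝ) =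
      -(p * q)/2 + 2 * p/(3 * q) + 2 * q/(3 * p) + 1/(6 * p * q)
        - 4 * (dedekindSum (2 * p) q + dedekindSum (2 * q) p) - 1 := by
  have hp0 : 0 < p := by omega
  have hq0 : 0 < q := by omega
  rw [← aux_full p q hp0 hq0 hop hoq hpq, sigHat_eq p q hp0 hq0 hop hoq hpq,
    aux_split p hp0, aux_boundary p q hp0 hoq]
  have h1 : ∀ k ∈ Finset.Icc 1 (p - 1),
      ∑ l ∈ Finset.range q, aeps p q (2 * (k * q + l * p))
      = aeps p q (2 * (k * q + 0 * p))
        + ∑ l ∈ Finset.Icc 1 (q - 1), aeps p q (2 * (k * q + l * p)) :=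
    fun k _ => aux_split q hq0 _
  have h2 := aux_boundary q p hq0 hop
  rw [aux_split p hp0] at h2
  have h3 : aeps q p (2 * (0 * p + 0 * q)) = 1 := by
    unfold aeps
    norm_num
  rw [h3] at h2
  rw [Finset.sum_congr rfl h1, Finset.sum_add_distrib]
  simp only [aeps_symm p q _ 0]
  linarith
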